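/- Let d ∈ {2,3} and let Ω ⊂ ℝ^d be a bounded open set. There exists a constant C₂ = C₂(Ω) such that for all continuously differentiable vector fields u, v, w : ℝ^d → ℝ^d with compact support contained in Ω, |b(u,v,w)| ≤ C₂ √(‖u‖ ‖∇u‖) ‖∇v‖ ‖∇w‖. -/

import Mathlib

open MeasureTheory

noncomputable section

/-- Partial derivative `∂_j f_i` at `x` of a vector field `f : ℝ^d → ℝ^d`. -/
def pd {d : ℕ} (f : (Fin d → ℝ) → (Fin d → ℝ)) (x : Fin d → ℝ) (j i : Fin d) : ℝ :=
  fderiv ℝ f x (Pi.single j (1 : ℝ)) i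

/-- Partial derivative `∂_j f` at `x` of a scalar function `f : ℝ^d → ℝ`. -/
def pdS {d : ℕ} (f : (Fin d → ℝ) → ℝ) (x : Fin d → ℝ) (j : Fin d) : ℝ :=
  fderiv ℝ f x (Pi.single j (1 : ℝ))

/-- Convective term `(u·∇v)_i` at `x`. -/
def conv {d : ℕ} (u v : (Fin d → ℝ) → (Fin d → ℝ)) (x : Fin d → ℝ) (i : Fin d) : ℝ :=
  ∑ j, u x j * pd v x j i

/-- Convective term `u·∇T` at `x` for a scalar `T`. -/
def convS {d : ℕ} (u : (Fin d → ℝ) → (Fin d → ℝ)) (T : (Fin d → ℝ) → ℝ)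
    (x : Fin d → ℝ) : ℝ :=
  ∑ j, u x j * pdS T x j

/-- Divergence `∇·u` at `x`. -/
def divg {d : ℕ} (u : (Fin d → ℝ) → (Fin d → ℝ)) (x : Fin d → ℝ) : ℝ :=
  ∑ j, pd u x j j

/-- Euclidean dot product on `ℝ^d`. -/
def dotv {d : ℕ} (a b : Fin d → ℝ) : ℝ := ∑ i, a i * b i

/-- `L²` norm of a vector field. -/
def l2norm {d : ℕ} (f : (Fin d → ℝ) → (Fin d → ℝ)) : ℝ :=
  (∫ x, ∑ i, (f x i) ^ 2) ^ (1 / 2 : ℝ)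

/-- `L²` norm of the Jacobian matrix of a vector field. -/
def gradNorm {d : ℕ} (f : (Fin d → ℝ) → (Fin d → ℝ)) : ℝ :=
  (∫ x, ∑ i, ∑ j, (pd f x j i) ^ 2) ^ (1 / 2 : ℝ)

/-- `L²` norm of a scalar function. -/
def l2normS {d : ℕ} (f : (Fin d → ℝ) → ℝ) : ℝ :=
  (∫ x, (f x) ^ 2) ^ (1 / 2 : ℝ)

/-- `L²` norm of the gradient of a scalar function. -/
def gradNormS {d : ℕ} (f : (Fin d → ℝ) → ℝ) : ℝ :=
  (∫ x, ∑ j, (pdS f x j) ^ 2) ^ (1 / 2 : ℝ)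

/-- `L^p` norm of a scalar function. -/
def lpnormS {d : ℕ} (p : ℝ) (f : (Fin d → ℝ) → ℝ) : ℝ :=
  (∫ x, |f x| ^ p) ^ (1 / p)

/-- The explicitly skew-symmetric trilinear form
`b(u,v,w) = ½(u·∇v, w) − ½(u·∇w, v)`. -/
def bform {d : ℕ} (u v w : (Fin d → ℝ) → (Fin d → ℝ)) : ℝ :=
  (1 / 2) * (∫ x, dotv (conv u v x) (w x)) - (1 / 2) * (∫ x, dotv (conv u w x) (v x))

/-- The explicitly skew-symmetric trilinear form
`b*(u,T,S) = ½(u·∇T, S) − ½(u·∇S, T)`. -/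
def bstar {d : ℕ} (u : (Fin d → ℝ) → (Fin d → ℝ)) (T S : (Fin d → ℝ) → ℝ) : ℝ :=
  (1 / 2) * (∫ x, convS u T x * S x) - (1 / 2) * (∫ x, convS u S x * T x)

open scoped ENNReal NNReal in
lemma aux_l2 {d : ℕ} {F : Type*} [NormedAddCommGroup F] (f : (Fin d → ℝ) → F)
    (g : (Fin d → ℝ) → ℝ) (c : ℝ) (hc : 0 ≤ c) (hg : Integrable g) (hg0 : ∀ x, 0 ≤ g x)
    (h : ∀ x, ‖f x‖ ^ 2 ≤ c * g x) :
    eLpNorm f 2 volume ≤ ENNReal.ofReal (c ^ (1 / 2 : ℝ) * (∫ x, g x) ^ (1 / 2 : ℝ)) := by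
  have hI : 0 ≤ ∫ x, g x := integral_nonneg hg0
  rw [eLpNorm_eq_lintegral_rpow_enorm_toReal (by norm_num) (by norm_num)]
  rw [← Real.mul_rpow hc hI, ← ENNReal.ofReal_rpow_of_nonneg (mul_nonneg hc hI) (by norm_num)]
  rw [ENNReal.toReal_ofNat]
  gcongr
  rw [← integral_const_mul, ofReal_integral_eq_lintegral_ofReal (hg.const_mul c)
    (Filter.Eventually.of_forall fun x => mul_nonneg hc (hg0 x))]
  apply lintegral_mono
  intro x
  beta_reduce
  rw [← ofReal_norm, ENNReal.ofReal_rpow_of_nonneg (norm_nonneg _) (by norm_num)]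
  apply ENNReal.ofReal_le_ofReal
  have := h x
  simpa using this

lemma aux_norm {d : ℕ} (y : Fin d → ℝ) : ‖y‖ ^ 2 ≤ ∑ i, (y i) ^ 2 := by
  have h : ‖y‖ ≤ Real.sqrt (∑ i, (y i) ^ 2) := by
    rw [pi_norm_le_iff_of_nonneg (Real.sqrt_nonneg _)]
    intro i
    apply Real.le_sqrt_of_sq_le
    rw [Real.norm_eq_abs, sq_abs]
    exact Finset.single_le_sum (f := fun i => (y i) ^ 2) (fun i _ => sq_nonneg _)
      (Finset.mem_univ i)
  calc ‖y‖ ^ 2 ≤ (Real.sqrt (∑ i, (y i) ^ 2)) ^ 2 := by gcongr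
    _ = _ := Real.sq_sqrt (Finset.sum_nonneg fun i _ => sq_nonneg _)

lemma aux_opnorm {d : ℕ} (L : (Fin d → ℝ) →L[ℝ] (Fin d → ℝ)) :
    ‖L‖ ^ 2 ≤ d * ∑ i, ∑ j, (L (Pi.single j (1 : ℝ)) i) ^ 2 := by
  have h : ‖L‖ ≤ ∑ j, ‖L (Pi.single j (1 : ℝ))‖ := by
    apply L.opNorm_le_bound (Finset.sum_nonneg fun i _ => norm_nonneg _)
    intro y
    have hy : L y = ∑ j, y j • L (Pi.single j (1 : ℝ)) := by
      conv_lhs => rw [pi_eq_sum_univ' y]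
      rw [map_sum]
      refine Finset.sum_congr rfl fun j _ => ?_
      rw [map_smul]
    rw [hy, Finset.sum_mul]
    refine (norm_sum_le _ _).trans (Finset.sum_le_sum fun j _ => ?_)
    rw [norm_smul, mul_comm]
    gcongr
    exact norm_le_pi_norm y j
  calc ‖L‖ ^ 2 ≤ (∑ j, ‖L (Pi.single j (1 : ℝ))‖) ^ 2 := by gcongr
    _ ≤ d * ∑ j, ‖L (Pi.single j (1 : ℝ))‖ ^ 2 := by
      have := sq_sum_le_card_mul_sum_sq (s := Finset.univ)
        (f := fun j => ‖L (Pi.single j (1 : ℝ))‖)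
      simpa using this
    _ ≤ _ := by
      rw [Finset.sum_comm]
      gcongr
      exact aux_norm _

lemma aux_u {d : ℕ} (u : (Fin d → ℝ) → (Fin d → ℝ)) (hu : ContDiff ℝ 1 u)
    (hc : HasCompactSupport u) :
    eLpNorm u 2 volume ≤ ENNReal.ofReal (l2norm u) := by
  have := aux_l2 u (fun x => ∑ i, (u x i) ^ 2) 1 zero_le_one ?_
    (fun x => Finset.sum_nonneg fun i _ => sq_nonneg _)
    (fun x => by simpa using aux_norm (u x))
  · simpa [l2norm] using this
  · have hcu := hu.continuous
    apply Continuous.integrable_of_hasCompactSupport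
    · fun_prop
    · exact hc.comp_left (g := fun y : Fin d → ℝ => ∑ i, (y i) ^ 2) (by simp)

lemma aux_du {d : ℕ} (u : (Fin d → ℝ) → (Fin d → ℝ)) (hu : ContDiff ℝ 1 u)
    (hc : HasCompactSupport u) :
    eLpNorm (fderiv ℝ u) 2 volume ≤ ENNReal.ofReal ((d : ℝ) ^ (1 / 2 : ℝ) * gradNorm u) := by
  refine aux_l2 (fderiv ℝ u) (fun x => ∑ i, ∑ j, (pd u x j i) ^ 2) d (Nat.cast_nonneg d) ?_
    (fun x => Finset.sum_nonneg fun i _ => Finset.sum_nonneg fun i _ => sq_nonneg _)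
    (fun x => aux_opnorm (fderiv ℝ u x))
  have hcu := hu.continuous_fderiv one_ne_zero
  apply Continuous.integrable_of_hasCompactSupport
  · unfold pd
    fun_prop
  · exact (hc.fderiv ℝ).comp_left (g := fun L : (Fin d → ℝ) →L[ℝ] (Fin d → ℝ) =>
      ∑ i, ∑ j, (L (Pi.single j (1 : ℝ)) i) ^ 2) (by simp)

open scoped ENNReal NNReal in
lemma aux_incl {d : ℕ} {F : Type*} [NormedAddCommGroup F] (f : (Fin d → ℝ) → F)
    (Ω : Set (Fin d → ℝ)) (p : ℝ≥0) (hp : p ≤ 2) (hs : ∀ x, x ∉ Ω → f x = 0)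
    (hf : AEStronglyMeasurable f volume) :
    eLpNorm f p volume ≤ eLpNorm f 2 volume * volume Ω ^ (1 / (p : ℝ) - 1 / 2) := by
  have hsupp : Function.support f ⊆ Ω := by
    intro x hx
    by_contra h
    exact hx (hs x h)
  rw [← eLpNorm_restrict_eq_of_support_subset hsupp,
    ← eLpNorm_restrict_eq_of_support_subset (p := 2) hsupp]
  have := eLpNorm_le_eLpNorm_mul_rpow_measure_univ (μ := volume.restrict Ω) (p := p) (q := 2)
    (by exact_mod_cast hp) hf.restrict
  simpa using this

open scoped ENNReal NNReal in
lemma aux_sob {d : ℕ} (hd : d = 2 ∨ d = 3) (Ω : Set (Fin d → ℝ))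
    (hΩb : Bornology.IsBounded Ω) :
    ∃ C : ℝ≥0, ∀ u : (Fin d → ℝ) → (Fin d → ℝ), ContDiff ℝ 1 u → HasCompactSupport u →
      tsupport u ⊆ Ω → eLpNorm u 6 volume ≤ C * eLpNorm (fderiv ℝ u) 2 volume := by
  obtain ⟨p, hp1, hp2, hp⟩ : ∃ p : ℝ≥0, 1 ≤ p ∧ p ≤ 2 ∧ (6 : ℝ)⁻¹ = (p : ℝ)⁻¹ - (d : ℝ)⁻¹ := by
    rcases hd with rfl | rfl
    · refine ⟨3 / 2, ?_, ?_, ?_⟩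
      · rw [← NNReal.coe_le_coe]; push_cast; norm_num
      · rw [← NNReal.coe_le_coe]; push_cast; norm_num
      · push_cast; norm_num
    · exact ⟨2, by norm_num, le_rfl, by push_cast; norm_num⟩
  have hd0 : 0 < d := by omega
  have hm : volume Ω < ∞ := hΩb.measure_lt_top
  have hex : 0 ≤ 1 / (p : ℝ) - 1 / 2 := by
    have : (p : ℝ) ≤ 2 := by exact_mod_cast hp2
    have h1 : (1 : ℝ) ≤ p := by exact_mod_cast hp1
    have := one_div_le_one_div_of_le (by linarith) this
    linarith
  set K : ℝ≥0∞ := volume Ω ^ (1 / (p : ℝ) - 1 / 2) with hK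
  have hKf : K ≠ ∞ := ENNReal.rpow_ne_top_of_nonneg hex hm.ne
  refine ⟨SNormLESNormFDerivOfEqConst (Fin d → ℝ) (volume : Measure (Fin d → ℝ)) p * K.toNNReal,
    fun u hu hc hs => ?_⟩
  have h1 := eLpNorm_le_eLpNorm_fderiv_of_eq (volume : Measure (Fin d → ℝ)) hu hc
    (p := p) (p' := 6) hp1 (by simpa using hd0) (by simpa using hp)
  have hsupp : Function.support (fderiv ℝ u) ⊆ Ω := (support_fderiv_subset ℝ).trans hs
  have h2 : eLpNorm (fderiv ℝ u) p volume ≤ eLpNorm (fderiv ℝ u) 2 volume * K := by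
    refine aux_incl (fderiv ℝ u) Ω p hp2 (fun x hx => ?_)
      (hu.continuous_fderiv one_ne_zero).aestronglyMeasurable
    by_contra h
    exact hx (hsupp h)
  calc eLpNorm u 6 volume ≤ _ := h1
    _ ≤ SNormLESNormFDerivOfEqConst (Fin d → ℝ) (volume : Measure (Fin d → ℝ)) p *
        (eLpNorm (fderiv ℝ u) 2 volume * K) := by gcongr
    _ = _ := by
      rw [ENNReal.coe_mul, ENNReal.coe_toNNReal hKf]
      ring

open scoped ENNReal NNReal in
lemma aux_holder {d : ℕ} (u w : (Fin d → ℝ) → (Fin d → ℝ))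
    (D : (Fin d → ℝ) → ((Fin d → ℝ) →L[ℝ] (Fin d → ℝ))) (hu : Continuous u) (hw : Continuous w)
    (hD : Continuous D) :
    ∫⁻ x, ‖u x‖ₑ * ‖D x‖ₑ * ‖w x‖ₑ ≤
      eLpNorm u 2 volume ^ (1 / 2 : ℝ) * eLpNorm u 6 volume ^ (1 / 2 : ℝ) *
        eLpNorm D 2 volume * eLpNorm w 6 volume := by
  have h := ENNReal.lintegral_prod_norm_pow_le (μ := (volume : Measure (Fin d → ℝ)))
    (Finset.univ : Finset (Fin 4))
    (f := ![fun x => ‖u x‖ₑ ^ (2 : ℝ), fun x => ‖u x‖ₑ ^ (6 : ℝ), fun x => ‖D x‖ₑ ^ (2 : ℝ),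
      fun x => ‖w x‖ₑ ^ (6 : ℝ)]) (p := ![1 / 4, 1 / 12, 1 / 2, 1 / 6])
    (by
      intro i _
      fin_cases i
      · exact (hu.enorm.measurable.pow_const _).aemeasurable
      · exact (hu.enorm.measurable.pow_const _).aemeasurable
      · exact (hD.enorm.measurable.pow_const _).aemeasurable
      · exact (hw.enorm.measurable.pow_const _).aemeasurable)
    (by simp [Fin.sum_univ_four]; norm_num)
    (by intro i _; fin_cases i <;> simp)
  simp only [Fin.prod_univ_four, Matrix.cons_val] at h
  rw [eLpNorm_eq_lintegral_rpow_enorm_toReal (p := 2) (by norm_num) (by norm_num),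
    eLpNorm_eq_lintegral_rpow_enorm_toReal (p := 6) (by norm_num) (by norm_num),
    eLpNorm_eq_lintegral_rpow_enorm_toReal (p := 2) (by norm_num) (by norm_num),
    eLpNorm_eq_lintegral_rpow_enorm_toReal (p := 6) (by norm_num) (by norm_num)]
  simp only [ENNReal.toReal_ofNat, ← ENNReal.rpow_mul] at h ⊢
  norm_num at h ⊢
  refine le_trans (le_of_eq (lintegral_congr fun x => ?_)) h
  rw [← ENNReal.rpow_add_of_nonneg _ _ (by norm_num) (by norm_num)]
  norm_num

lemma aux_dot {d : ℕ} (u v w : (Fin d → ℝ) → (Fin d → ℝ)) (x : Fin d → ℝ) :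
    ‖dotv (conv u v x) (w x)‖ ≤ (d : ℝ) ^ 2 * (‖u x‖ * ‖fderiv ℝ v x‖ * ‖w x‖) := by
  have hpd : ∀ i j, ‖pd v x j i‖ ≤ ‖fderiv ℝ v x‖ := by
    intro i j
    refine (norm_le_pi_norm _ i).trans ?_
    refine ((fderiv ℝ v x).le_opNorm _).trans ?_
    rw [Pi.norm_single, norm_one, mul_one]
  have hc : ∀ i, ‖conv u v x i‖ ≤ d * (‖u x‖ * ‖fderiv ℝ v x‖) := by
    intro i
    refine (norm_sum_le _ _).trans ?_
    refine (Finset.sum_le_sum (g := fun _ => ‖u x‖ * ‖fderiv ℝ v x‖) fun j _ => ?_).trans ?_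
    · rw [norm_mul]
      gcongr
      · exact norm_le_pi_norm _ _
      · exact hpd i j
    · simp
  refine (norm_sum_le _ _).trans ?_
  refine (Finset.sum_le_sum
    (g := fun _ => d * (‖u x‖ * ‖fderiv ℝ v x‖) * ‖w x‖) fun j _ => ?_).trans ?_
  · rw [norm_mul]
    gcongr
    · exact hc j
    · exact norm_le_pi_norm _ _
  · simp
    apply le_of_eq
    ring

open scoped ENNReal NNReal in
lemma aux_main {d : ℕ} (hd : d = 2 ∨ d = 3) (Ω : Set (Fin d → ℝ))
    (hΩb : Bornology.IsBounded Ω) :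
    ∃ C : ℝ, ∀ u v w : (Fin d → ℝ) → (Fin d → ℝ),
      ContDiff ℝ 1 u → ContDiff ℝ 1 v → ContDiff ℝ 1 w →
      HasCompactSupport u → HasCompactSupport v → HasCompactSupport w →
      tsupport u ⊆ Ω → tsupport v ⊆ Ω → tsupport w ⊆ Ω →
      |∫ x, dotv (conv u v x) (w x)| ≤
        C * Real.sqrt (l2norm u * gradNorm u) * gradNorm v * gradNorm w := by
  obtain ⟨K, hK⟩ := aux_sob hd Ω hΩb
  set s : ℝ := (d : ℝ) ^ (1 / 2 : ℝ) with hs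
  have hs0 : 0 ≤ s := by positivity
  refine ⟨(d : ℝ) ^ 2 * ((K * s) ^ (1 / 2 : ℝ) * s * (K * s)),
    fun u v w hu hv hw cu cv cw su sv sw => ?_⟩
  have l0 : 0 ≤ l2norm u := Real.rpow_nonneg (integral_nonneg fun x =>
    Finset.sum_nonneg fun i _ => sq_nonneg _) _
  have g0 : ∀ f : (Fin d → ℝ) → (Fin d → ℝ), 0 ≤ gradNorm f := fun f =>
    Real.rpow_nonneg (integral_nonneg fun x =>
      Finset.sum_nonneg fun i _ => Finset.sum_nonneg fun i _ => sq_nonneg _) _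
  have gu := g0 u
  have gv := g0 v
  have gw := g0 w
  have h6 : ∀ f : (Fin d → ℝ) → (Fin d → ℝ), ContDiff ℝ 1 f → HasCompactSupport f →
      tsupport f ⊆ Ω → eLpNorm f 6 volume ≤ ENNReal.ofReal (K * s * gradNorm f) := by
    intro f h1 h2 h3
    refine (hK f h1 h2 h3).trans ?_
    rw [mul_assoc, ENNReal.ofReal_mul K.coe_nonneg, ENNReal.ofReal_coe_nnreal]
    gcongr
    exact aux_du f h1 h2
  have hR : (0 : ℝ) ≤ (d : ℝ) ^ 2 * (l2norm u ^ (1 / 2 : ℝ) *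
      (K * s * gradNorm u) ^ (1 / 2 : ℝ) * (s * gradNorm v) * (K * s * gradNorm w)) := by
    positivity
  have key : ‖∫ x, dotv (conv u v x) (w x)‖ₑ ≤ ENNReal.ofReal
      ((d : ℝ) ^ 2 * (l2norm u ^ (1 / 2 : ℝ) * (K * s * gradNorm u) ^ (1 / 2 : ℝ) *
        (s * gradNorm v) * (K * s * gradNorm w))) := by
    calc ‖∫ x, dotv (conv u v x) (w x)‖ₑ ≤ ∫⁻ x, ‖dotv (conv u v x) (w x)‖ₑ :=
          enorm_integral_le_lintegral_enorm _
      _ ≤ ∫⁻ x, ENNReal.ofReal ((d : ℝ) ^ 2) * (‖u x‖ₑ * ‖fderiv ℝ v x‖ₑ * ‖w x‖ₑ) := by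
          apply lintegral_mono
          intro x
          simp only [← ofReal_norm]
          rw [← ENNReal.ofReal_mul (by positivity), ← ENNReal.ofReal_mul (by positivity),
            ← ENNReal.ofReal_mul (by positivity)]
          exact ENNReal.ofReal_le_ofReal (aux_dot u v w x)
      _ = ENNReal.ofReal ((d : ℝ) ^ 2) * ∫⁻ x, (‖u x‖ₑ * ‖fderiv ℝ v x‖ₑ * ‖w x‖ₑ) :=
          lintegral_const_mul' _ _ ENNReal.ofReal_ne_top
      _ ≤ ENNReal.ofReal ((d : ℝ) ^ 2) * (eLpNorm u 2 volume ^ (1 / 2 : ℝ) *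
            eLpNorm u 6 volume ^ (1 / 2 : ℝ) *
            eLpNorm (fderiv ℝ v) 2 volume * eLpNorm w 6 volume) := by
          gcongr
          exact aux_holder u w _ hu.continuous hw.continuous (hv.continuous_fderiv one_ne_zero)
      _ ≤ ENNReal.ofReal ((d : ℝ) ^ 2) * (ENNReal.ofReal (l2norm u) ^ (1 / 2 : ℝ) *
            ENNReal.ofReal (K * s * gradNorm u) ^ (1 / 2 : ℝ) *
            ENNReal.ofReal (s * gradNorm v) * ENNReal.ofReal (K * s * gradNorm w)) := by
          gcongr
          · exact aux_u u hu cu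
          · exact h6 u hu cu su
          · exact aux_du v hv cv
          · exact h6 w hw cw sw
      _ = _ := by
          rw [ENNReal.ofReal_rpow_of_nonneg l0 (by norm_num),
            ENNReal.ofReal_rpow_of_nonneg (by positivity) (by norm_num),
            ← ENNReal.ofReal_mul (by positivity), ← ENNReal.ofReal_mul (by positivity),
            ← ENNReal.ofReal_mul (by positivity), ← ENNReal.ofReal_mul (by positivity)]
  rw [← ofReal_norm, ENNReal.ofReal_le_ofReal_iff hR, Real.norm_eq_abs] at key
  refine key.trans (le_of_eq ?_)
  rw [Real.sqrt_eq_rpow, Real.mul_rpow l0 gu, Real.mul_rpow (by positivity) gu]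
  ring

/-- For `d ∈ {2,3}` and a bounded open `Ω ⊂ ℝ^d`, there is `C₂ = C₂(Ω)`
such that for all C¹ vector fields with compact support in `Ω`,
`|b(u,v,w)| ≤ C₂ √(‖u‖ ‖∇u‖) ‖∇v‖ ‖∇w‖`. -/
theorem statement3 {d : ℕ} (hd : d = 2 ∨ d = 3)
    (Ω : Set (Fin d → ℝ)) (hΩo : IsOpen Ω) (hΩb : Bornology.IsBounded Ω) :
    ∃ C₂ : ℝ, ∀ u v w : (Fin d → ℝ) → (Fin d → ℝ),
      ContDiff ℝ 1 u → ContDiff ℝ 1 v → ContDiff ℝ 1 w →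
      HasCompactSupport u → HasCompactSupport v → HasCompactSupport w →
      tsupport u ⊆ Ω → tsupport v ⊆ Ω → tsupport w ⊆ Ω →
      |bform u v w| ≤ C₂ * Real.sqrt (l2norm u * gradNorm u) * gradNorm v * gradNorm w := by
  obtain ⟨C, hC⟩ := aux_main hd Ω hΩb
  refine ⟨C, fun u v w hu hv hw cu cv cw su sv sw => ?_⟩
  have h1 := hC u v w hu hv hw cu cv cw su sv sw
  have h2 := hC u w v hu hw hv cu cw cv su sw sv
  unfold bform
  rw [abs_le] at h1 h2 ⊢
  constructor <;> nlinarith [h1.1, h1.2, h2.1, h2.2]
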